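/- Let H be an rw-history. Let SG*(H) denote the transitive closure of the 1-version serializability graph of H, and let MVSG*(MV(H)) denote the transitive closure of the multiversion serializability graph of MV(H) taken with respect to any write version order. Then the two graphs are identical: SG*(H) = MVSG*(MV(H)). -/

import Mathlib

/-! ## Formalization of MC-transactions and MC-histories
(Pfeifer & Lockemann, "Theory and Practice of Transactional Method Caching") -/

/-- Types of operations: read, write, method, commit, abort. -/
inductive OpKind : Type where
  | r | w | m | c | a
deriving DecidableEq

/-- Operations of MC-histories over data elements of type `D`:
`read i j x` is `r_i^j[x]`, `write i x` is `w_i[x]`, `meth i k l` is `m_i^{k,l}`,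
`commit i` is `c_i` and `abort i` is `a_i`. -/
inductive MCOp (D : Type) : Type where
  | read  (i j : ℕ) (x : D)
  | write (i : ℕ) (x : D)
  | meth  (i k l : ℕ)
  | commit (i : ℕ)
  | abort (i : ℕ)

namespace MCOp
variable {D : Type}

/-- The index of the transaction an operation belongs to. -/
def tx : MCOp D → ℕ
  | read i _ _ => i
  | write i _ => i
  | meth i _ _ => i
  | commit i => i
  | abort i => i

/-- The type `a(p)` of an operation. -/
def kind : MCOp D → OpKind
  | read _ _ _ => .r
  | write _ _ => .w
  | meth _ _ _ => .m
  | commit _ => .c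
  | abort _ => .a

end MCOp

/-- The set `d(p)` of data elements of an operation (relative to a history's operation set,
which is needed for method operations). -/
def dset {D : Type} (ops : Set (MCOp D)) : MCOp D → Set D
  | .read _ _ x => {x}
  | .write _ x => {x}
  | .meth _ k l => {x | MCOp.read k l x ∈ ops}
  | .commit _ => ∅
  | .abort _ => ∅

/-- Two operations conflict (`u ∦ v`). -/
def conflict {D : Type} (ops : Set (MCOp D)) (p q : MCOp D) : Prop :=
  (dset ops p ∩ dset ops q).Nonempty ∧
  ((p.tx ≠ q.tx ∧ (p.kind = OpKind.w ∨ q.kind = OpKind.w)) ∨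
   (p.kind = OpKind.w ∧ q.kind = OpKind.m) ∨
   (p.kind = OpKind.m ∧ q.kind = OpKind.w))

theorem dset_nonmeth {D : Type} (ops1 ops2 : Set (MCOp D)) (p : MCOp D)
    (h : p.kind ≠ OpKind.m) : dset ops1 p = dset ops2 p := by
  cases p <;> simp [dset, MCOp.kind] at *

theorem conflict_nonmeth {D : Type} (ops1 ops2 : Set (MCOp D)) (p q : MCOp D)
    (hp : p.kind ≠ OpKind.m) (hq : q.kind ≠ OpKind.m) :
    conflict ops1 p q → conflict ops2 p q := by
  rintro ⟨h1, h2⟩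
  refine ⟨?_, h2⟩
  rwa [dset_nonmeth ops1 ops2 p hp, dset_nonmeth ops1 ops2 q hq] at h1

/-- A (well defined) MC-history `H` over MC-transactions `T_1, …, T_n`.
The transaction `T_i` is the set of operations `p ∈ ops` with `p.tx = i`;
`lt` is the partial order `<` of the history (by `lt_mem` it only relates
operations of the history and it restricts to the orders `<_i`). -/
structure MCHistory (D : Type) : Type where
  /-- number of transactions -/
  n : ℕ
  /-- the operations of the history -/
  ops : Set (MCOp D)
  /-- the partial ordering relation `<` -/
  lt : MCOp D → MCOp D → Prop
  tx_mem : ∀ p ∈ ops, 1 ≤ p.tx ∧ p.tx ≤ n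
  lt_irrefl : ∀ p, ¬ lt p p
  lt_trans : ∀ p q r, lt p q → lt q r → lt p r
  lt_mem : ∀ p q, lt p q → p ∈ ops ∧ q ∈ ops
  /-- `a_i ∈ T_i ↔ c_i ∉ T_i` -/
  abort_commit : ∀ i, 1 ≤ i → i ≤ n → (MCOp.abort i ∈ ops ↔ MCOp.commit i ∉ ops)
  /-- every non-termination operation precedes `a_i` or `c_i` -/
  terminate : ∀ p ∈ ops, p.kind ≠ OpKind.c → p.kind ≠ OpKind.a →
      lt p (MCOp.abort p.tx) ∨ lt p (MCOp.commit p.tx)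
  /-- `r_i^j[x] <_i w_i[x] ↔ ¬ (w_i[x] <_i r_i^j[x])` -/
  rw_order : ∀ (i j : ℕ) (x : D), MCOp.read i j x ∈ ops → MCOp.write i x ∈ ops →
      (lt (MCOp.read i j x) (MCOp.write i x) ↔ ¬ lt (MCOp.write i x) (MCOp.read i j x))
  /-- for `m_i^{k,l} ∈ H`, `k ∈ {1,…,n}` -/
  meth_range : ∀ i k l, MCOp.meth i k l ∈ ops → 1 ≤ k ∧ k ≤ n
  /-- for `m_i^{k,l} ∈ H`, every `r_k^l[x] ∈ H` satisfies `r_k^l[x] < m_i^{k,l}` -/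
  meth_reads : ∀ i k l, MCOp.meth i k l ∈ ops → ∀ x : D, MCOp.read k l x ∈ ops →
      lt (MCOp.read k l x) (MCOp.meth i k l)
  /-- well definedness: conflicting operations are ordered -/
  well_defined : ∀ p ∈ ops, ∀ q ∈ ops, conflict ops p q → lt p q ∨ lt q p

namespace MCHistory
variable {D : Type}

/-- The rw-projection `RW(H)`: all operations of `H` except method operations,
with the order restricted accordingly. -/
def RW (H : MCHistory D) : MCHistory D where
  n := H.n
  ops := {p | p ∈ H.ops ∧ p.kind ≠ OpKind.m}
  lt := fun p q => H.lt p q ∧ p.kind ≠ OpKind.m ∧ q.kind ≠ OpKind.m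
  tx_mem := fun p hp => H.tx_mem p hp.1
  lt_irrefl := fun p h => H.lt_irrefl p h.1
  lt_trans := fun p q r h1 h2 => ⟨H.lt_trans p q r h1.1 h2.1, h1.2.1, h2.2.2⟩
  lt_mem := fun p q h => ⟨⟨(H.lt_mem p q h.1).1, h.2.1⟩, (H.lt_mem p q h.1).2, h.2.2⟩
  abort_commit := by
    intro i h1 h2
    have h := H.abort_commit i h1 h2
    constructor
    · intro hp hc
      exact (h.mp hp.1) hc.1
    · intro hp
      refine ⟨h.mpr fun hc => hp ⟨hc, ?_⟩, ?_⟩ <;> simp [MCOp.kind]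
  terminate := by
    intro p hp hc ha
    rcases H.terminate p hp.1 hc ha with h | h
    · exact Or.inl ⟨h, hp.2, by simp [MCOp.kind]⟩
    · exact Or.inr ⟨h, hp.2, by simp [MCOp.kind]⟩
  rw_order := by
    intro i j x hr hw
    have h := H.rw_order i j x hr.1 hw.1
    constructor
    · intro hlt hlt2
      exact (h.mp hlt.1) hlt2.1
    · intro hlt
      refine ⟨h.mpr fun h2 => hlt ⟨h2, ?_, ?_⟩, ?_, ?_⟩ <;> simp [MCOp.kind]
  meth_range := by
    intro i k l hm
    exact absurd rfl hm.2
  meth_reads := by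
    intro i k l hm
    exact absurd rfl hm.2
  well_defined := by
    intro p hp q hq hc
    have hc' : conflict H.ops p q := conflict_nonmeth _ _ p q hp.2 hq.2 hc
    rcases H.well_defined p hp.1 q hq.1 hc' with h | h
    · exact Or.inl ⟨h, hp.2, hq.2⟩
    · exact Or.inr ⟨h, hq.2, hp.2⟩

/-- `reads(T_i, x, T_j, p)`: transaction `T_i` reads `x` from `T_j` via the operation `p`. -/
def readsVia (H : MCHistory D) (i : ℕ) (x : D) (j : ℕ) (p : MCOp D) : Prop :=
  ∃ h k : ℕ, MCOp.read h k x ∈ H.ops ∧ MCOp.write j x ∈ H.ops ∧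
    H.lt (MCOp.write j x) (MCOp.read h k x) ∧
    ((h = i ∧ p = MCOp.read h k x) ∨
      (h ≠ i ∧ MCOp.meth i h k ∈ H.ops ∧ p = MCOp.meth i h k)) ∧
    ¬ H.lt (MCOp.abort j) (MCOp.read h k x) ∧
    ∀ o : ℕ, MCOp.write o x ∈ H.ops → H.lt (MCOp.write j x) (MCOp.write o x) →
      H.lt (MCOp.write o x) (MCOp.read h k x) →
      H.lt (MCOp.abort o) (MCOp.read h k x)

/-- `H` is recoverable. -/
def Recoverable (H : MCHistory D) : Prop :=
  ∀ (i j : ℕ) (x : D) (p : MCOp D), i ≠ j → H.readsVia i x j p →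
    MCOp.commit i ∈ H.ops → H.lt (MCOp.commit j) (MCOp.commit i)

/-- `H` avoids cascading aborts (ACA). -/
def ACA (H : MCHistory D) : Prop :=
  ∀ (i j : ℕ) (x : D) (p : MCOp D), i ≠ j → H.readsVia i x j p →
    H.lt (MCOp.commit j) p

/-- `H` is strict. -/
def Strict (H : MCHistory D) : Prop :=
  H.ACA ∧ ∀ (i j : ℕ) (x : D), MCOp.write i x ∈ H.ops → MCOp.write j x ∈ H.ops →
    i ≠ j → H.lt (MCOp.write j x) (MCOp.write i x) →
    (H.lt (MCOp.abort j) (MCOp.write i x) ∨ H.lt (MCOp.commit j) (MCOp.write i x))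

/-- The 1-version serializability graph `SG(H)` of an rw-history. -/
def SG (H : MCHistory D) (i j : ℕ) : Prop :=
  i ≠ j ∧ MCOp.commit i ∈ H.ops ∧ MCOp.commit j ∈ H.ops ∧
  ∃ p q : MCOp D, p ∈ H.ops ∧ q ∈ H.ops ∧ p.tx = i ∧ q.tx = j ∧
    conflict H.ops p q ∧ H.lt p q

/-- The MC-serializability graph `MCSG(H)`. -/
def MCSG (H : MCHistory D) (i j : ℕ) : Prop :=
  MCOp.commit i ∈ H.ops ∧ MCOp.commit j ∈ H.ops ∧
  ((∃ p q : MCOp D, p ∈ H.ops ∧ q ∈ H.ops ∧ p.tx = i ∧ q.tx = j ∧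
      p.kind ≠ OpKind.m ∧ q.kind ≠ OpKind.m ∧ conflict H.ops p q ∧ H.lt p q) ∨
   (∃ (k l : ℕ) (x : D), MCOp.meth i k l ∈ H.ops ∧ MCOp.write j x ∈ H.ops ∧
      MCOp.read k l x ∈ H.ops ∧ H.lt (MCOp.read k l x) (MCOp.write j x) ∧
      (i ≠ j ∨ H.lt (MCOp.write j x) (MCOp.meth i k l))) ∨
   (i ≠ j ∧ ∃ (k l : ℕ) (x : D), MCOp.write i x ∈ H.ops ∧ MCOp.meth j k l ∈ H.ops ∧
      MCOp.read k l x ∈ H.ops ∧ H.lt (MCOp.write i x) (MCOp.read k l x)))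

/-- `ts` is a timestamp function for `H`: it assigns pairwise distinct
natural numbers to the transactions of `H`. -/
def TimestampFn (H : MCHistory D) (ts : ℕ → ℕ) : Prop :=
  ∀ i j : ℕ, 1 ≤ i → i ≤ H.n → 1 ≤ j → j ≤ H.n → ts i = ts j → i = j

/-- `H` is t-ordered w.r.t. `ts`. -/
def TOrdered (H : MCHistory D) (ts : ℕ → ℕ) : Prop :=
  ∀ p ∈ H.ops, ∀ q ∈ H.ops, conflict H.ops p q → ts p.tx < ts q.tx →
    (MCOp.abort p.tx ∈ H.ops ∨ MCOp.abort q.tx ∈ H.ops ∨ H.lt p q)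

/-- `H` is rm-ordered w.r.t. `ts`. -/
def RMOrdered (H : MCHistory D) (ts : ℕ → ℕ) : Prop :=
  ∀ (i j k l : ℕ) (x : D), MCOp.write i x ∈ H.ops → MCOp.meth j k l ∈ H.ops →
    MCOp.read k l x ∈ H.ops →
    H.lt (MCOp.write i x) (MCOp.read k l x) →
    H.lt (MCOp.read k l x) (MCOp.meth j k l) →
    (MCOp.abort i ∈ H.ops ∨ MCOp.abort j ∈ H.ops ∨ ts i < ts j)

/-- `H` is irreflexive. -/
def IrreflexiveHist (H : MCHistory D) : Prop :=
  ∀ (i k l : ℕ) (x : D), MCOp.write i x ∈ H.ops → MCOp.meth i k l ∈ H.ops →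
    MCOp.read k l x ∈ H.ops →
    H.lt (MCOp.read k l x) (MCOp.write i x) →
    H.lt (MCOp.write i x) (MCOp.meth i k l) →
    MCOp.abort i ∈ H.ops

/-- `tsfit` satisfies the defining recursion of the fitting timestamp function
`ts_fit` on the committed transactions of `H`. -/
def TsFitSpec (H : MCHistory D) (ts tsfit : ℕ → ℕ) : Prop :=
  ∀ i : ℕ, MCOp.commit i ∈ H.ops →
    tsfit i = sInf (({ts i} : Set ℕ) ∪
      {v : ℕ | ∃ j : ℕ, MCOp.commit j ∈ H.ops ∧ ts j < ts i ∧
        (∃ (k l : ℕ) (x : D), MCOp.write j x ∈ H.ops ∧ MCOp.meth i k l ∈ H.ops ∧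
          MCOp.read k l x ∈ H.ops ∧ H.lt (MCOp.read k l x) (MCOp.write j x)) ∧
        v = tsfit j})

/-- `H` is t-fitting w.r.t. `ts` (with fitting timestamps `tsfit`). -/
def TFitting (H : MCHistory D) (ts tsfit : ℕ → ℕ) : Prop :=
  ∀ i j : ℕ, H.MCSG i j → ts i < ts j → ts i < tsfit j

/-- A reverse edge of `MCSG(H)` w.r.t. `ts`. -/
def RevEdge (H : MCHistory D) (ts : ℕ → ℕ) (i j : ℕ) : Prop :=
  H.MCSG i j ∧ ts j < ts i

end MCHistory
/-! ## Multiversion interpretation `MV(H)` -/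

/-- Superscripts of read operations in `MV(H)`: either original superscripts
(`Sum.inl j`), or fresh superscripts introduced for the reads replacing a method
operation `m_i^{k,l}` (`Sum.inr (Sum.inl (k,l))`), or the fresh superscript of the
companion read of a write operation (`Sum.inr (Sum.inr ())`). -/
abbrev MVSup : Type := ℕ ⊕ ((ℕ × ℕ) ⊕ Unit)

/-- Operations of multiversion histories: `read i h x v` is `r_i^h[x_v]`,
`write i x` is `w_i[x_i]` (a write always writes its own version). -/
inductive MVOp (D : Type) : Type where
  | read (i : ℕ) (h : MVSup) (x : D) (v : ℕ)
  | write (i : ℕ) (x : D)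
  | commit (i : ℕ)
  | abort (i : ℕ)

namespace MVOp
variable {D : Type}

/-- The preimage `mv⁻¹(p)` of a multiversion operation of `MV(H)` in `H`. -/
def pre : MVOp D → MCOp D
  | read i (Sum.inl j) x _ => MCOp.read i j x
  | read i (Sum.inr (Sum.inl kl)) _ _ => MCOp.meth i kl.1 kl.2
  | read i (Sum.inr (Sum.inr _)) x _ => MCOp.write i x
  | write i x => MCOp.write i x
  | commit i => MCOp.commit i
  | abort i => MCOp.abort i

end MVOp

namespace MCHistory
variable {D : Type}

/-- `V(p) = k` for data element `x`: `k` is the index of the last write operation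
`w_k[x] ∈ H` before `p` with `c_k ∈ H`; `k = 0` if no such write exists. -/
def lastWriteIdx (H : MCHistory D) (x : D) (p : MCOp D) (k : ℕ) : Prop :=
  (k = 0 ∧ ∀ o : ℕ, MCOp.write o x ∈ H.ops → MCOp.commit o ∈ H.ops →
      ¬ H.lt (MCOp.write o x) p) ∨
  (MCOp.write k x ∈ H.ops ∧ MCOp.commit k ∈ H.ops ∧ H.lt (MCOp.write k x) p ∧
    ∀ o : ℕ, MCOp.write o x ∈ H.ops → MCOp.commit o ∈ H.ops →
      H.lt (MCOp.write o x) p → (o = k ∨ H.lt (MCOp.write o x) (MCOp.write k x)))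

/-- The operations of the multiversion interpretation `MV(H)` of `H`,
i.e. `⋃_{p ∈ H} mv(p)`. -/
def MVops (H : MCHistory D) : Set (MVOp D) :=
  { q : MVOp D |
    (∃ (i j : ℕ) (x : D) (v : ℕ), MCOp.read i j x ∈ H.ops ∧
        H.lastWriteIdx x (MCOp.read i j x) v ∧ q = MVOp.read i (Sum.inl j) x v) ∨
    (∃ (i : ℕ) (x : D), MCOp.write i x ∈ H.ops ∧ q = MVOp.write i x) ∨
    (∃ (i : ℕ) (x : D) (v : ℕ), MCOp.write i x ∈ H.ops ∧
        (¬ ∃ k : ℕ, MCOp.read i k x ∈ H.ops ∧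
            H.lt (MCOp.read i k x) (MCOp.write i x)) ∧
        H.lastWriteIdx x (MCOp.write i x) v ∧
        q = MVOp.read i (Sum.inr (Sum.inr ())) x v) ∨
    (∃ (i k l : ℕ) (x : D) (v : ℕ), MCOp.meth i k l ∈ H.ops ∧
        MCOp.read k l x ∈ H.ops ∧ H.lastWriteIdx x (MCOp.read k l x) v ∧
        q = MVOp.read i (Sum.inr (Sum.inl (k, l))) x v) ∨
    (∃ i : ℕ, MCOp.commit i ∈ H.ops ∧ q = MVOp.commit i) ∨
    (∃ i : ℕ, MCOp.abort i ∈ H.ops ∧ q = MVOp.abort i) }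

/-- The ordering relation `<'` of `MV(H)`: `p <' q` iff `mv⁻¹(p) < mv⁻¹(q)` in `H`,
or `p` and `q` stem from the same method operation `m_i^{k,l}` and the underlying
reads satisfy `r_k^l[x] < r_k^l[y]`. -/
def mvlt (H : MCHistory D) (p q : MVOp D) : Prop :=
  H.lt p.pre q.pre ∨
  (∃ (i k l : ℕ) (x y : D) (vx vy : ℕ),
      p = MVOp.read i (Sum.inr (Sum.inl (k, l))) x vx ∧
      q = MVOp.read i (Sum.inr (Sum.inl (k, l))) y vy ∧
      H.lt (MCOp.read k l x) (MCOp.read k l y))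

end MCHistory

/-- `vlt` is a version order: for every data element it totally orders the
versions, with version `0` (the initial version) as the smallest one. -/
def IsVersionOrder {D : Type} (vlt : D → ℕ → ℕ → Prop) : Prop :=
  (∀ (x : D) (i : ℕ), ¬ vlt x i i) ∧
  (∀ (x : D) (i j k : ℕ), vlt x i j → vlt x j k → vlt x i k) ∧
  (∀ (x : D) (i : ℕ), i ≠ 0 → vlt x 0 i) ∧
  (∀ (x : D) (i j : ℕ), i ≠ 0 → j ≠ 0 → i ≠ j → vlt x i j ∨ vlt x j i)

namespace MCHistory
variable {D : Type}

/-- `vlt` is a write version order for `MV(H)`: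
`w_i[x_i] <' w_j[x_j] ∨ i = 0` implies `x_i ≪ x_j`. -/
def IsWriteVersionOrder (H : MCHistory D) (vlt : D → ℕ → ℕ → Prop) : Prop :=
  ∀ (i j : ℕ) (x : D), MVOp.write i x ∈ H.MVops → MVOp.write j x ∈ H.MVops →
    (H.mvlt (MVOp.write i x) (MVOp.write j x) ∨ i = 0) → vlt x i j

/-- The multiversion serializability graph `MVSG` of `MV(H)` w.r.t. the
version order `vlt`: there is an edge `T_i → T_j` iff both transactions are committed
and there are operations `r_k^h[x_l], w_m[x_m] ∈ MV(H)` realizing one of the four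
defining clauses. -/
def MVSG (H : MCHistory D) (vlt : D → ℕ → ℕ → Prop) (i j : ℕ) : Prop :=
  MVOp.commit i ∈ H.MVops ∧ MVOp.commit j ∈ H.MVops ∧
  ∃ (k : ℕ) (h : MVSup) (x : D) (l m : ℕ),
    MVOp.read k h x l ∈ H.MVops ∧ MVOp.write m x ∈ H.MVops ∧
    ((i = j ∧ j = k ∧ k = m ∧ i ≠ l ∧ H.mvlt (MVOp.write i x) (MVOp.read i h x l)) ∨
     (i ≠ j ∧ m = i ∧ i = l ∧ k = j) ∨
     (i ≠ j ∧ m = i ∧ l = j ∧ vlt x m l) ∨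
     (i ≠ j ∧ k = i ∧ m = j ∧ vlt x l m))

end MCHistory

namespace MCHistory
variable {D : Type} (H : MCHistory D)

theorem write_ne_zero {i : ℕ} {x : D} (h : MCOp.write i x ∈ H.ops) : i ≠ 0 := by
  have := (H.tx_mem _ h).1
  simp only [MCOp.tx] at this
  omega

theorem commit_ne_zero {i : ℕ} (h : MCOp.commit i ∈ H.ops) : i ≠ 0 := by
  have := (H.tx_mem _ h).1
  simp only [MCOp.tx] at this
  omega

theorem conflict_write_write {i j : ℕ} (x : D) (hij : i ≠ j) :
    conflict H.ops (.write i x) (.write j x) :=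
  ⟨⟨x, rfl, rfl⟩, Or.inl ⟨hij, Or.inl rfl⟩⟩

theorem conflict_write_read {i j : ℕ} (k : ℕ) (x : D) (hij : i ≠ j) :
    conflict H.ops (.write i x) (.read j k x) :=
  ⟨⟨x, rfl, rfl⟩, Or.inl ⟨hij, Or.inl rfl⟩⟩

theorem conflict_read_write {i j : ℕ} (k : ℕ) (x : D) (hij : i ≠ j) :
    conflict H.ops (.read i k x) (.write j x) :=
  ⟨⟨x, rfl, rfl⟩, Or.inl ⟨hij, Or.inr rfl⟩⟩

theorem lt_or_lt_of_write {i j : ℕ} {x : D} (hi : MCOp.write i x ∈ H.ops)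
    (hj : MCOp.write j x ∈ H.ops) (hij : i ≠ j) :
    H.lt (.write i x) (.write j x) ∨ H.lt (.write j x) (.write i x) :=
  H.well_defined _ hi _ hj (H.conflict_write_write x hij)

theorem exists_lastWriteIdx (x : D) (p : MCOp D) : ∃ v, H.lastWriteIdx x p v := by
  have key : ∀ N : ℕ,
      (∀ o < N, MCOp.write o x ∈ H.ops → MCOp.commit o ∈ H.ops → ¬ H.lt (.write o x) p) ∨
      ∃ k, MCOp.write k x ∈ H.ops ∧ MCOp.commit k ∈ H.ops ∧ H.lt (.write k x) p ∧
        ∀ o < N, MCOp.write o x ∈ H.ops → MCOp.commit o ∈ H.ops → H.lt (.write o x) p →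
          (o = k ∨ H.lt (.write o x) (.write k x)) := by
    intro N
    induction N with
    | zero => exact Or.inl fun o ho => absurd ho (Nat.not_lt_zero o)
    | succ N ih =>
      by_cases hN : MCOp.write N x ∈ H.ops ∧ MCOp.commit N ∈ H.ops ∧ H.lt (.write N x) p
      · right
        obtain ⟨hw, hc, hlt⟩ := hN
        rcases ih with h | ⟨k, hkw, hkc, hkl, hk⟩
        · refine ⟨N, hw, hc, hlt, fun o ho how hoc hol => ?_⟩
          rcases Nat.lt_succ_iff_lt_or_eq.mp ho with ho | rfl
          · exact absurd hol (h o ho how hoc)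
          · exact Or.inl rfl
        · by_cases hNk : N = k ∨ H.lt (.write N x) (.write k x)
          · refine ⟨k, hkw, hkc, hkl, fun o ho how hoc hol => ?_⟩
            rcases Nat.lt_succ_iff_lt_or_eq.mp ho with ho | rfl
            · exact hk o ho how hoc hol
            · exact hNk
          · push Not at hNk
            have hkN := (H.lt_or_lt_of_write hw hkw hNk.1).resolve_left hNk.2
            refine ⟨N, hw, hc, hlt, fun o ho how hoc hol => ?_⟩
            rcases Nat.lt_succ_iff_lt_or_eq.mp ho with ho | rfl
            · rcases hk o ho how hoc hol with rfl | h
              · exact Or.inr hkN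
              · exact Or.inr (H.lt_trans _ _ _ h hkN)
            · exact Or.inl rfl
      · rcases ih with h | ⟨k, hkw, hkc, hkl, hk⟩
        · refine Or.inl fun o ho how hoc hol => ?_
          rcases Nat.lt_succ_iff_lt_or_eq.mp ho with ho | rfl
          · exact h o ho how hoc hol
          · exact hN ⟨how, hoc, hol⟩
        · refine Or.inr ⟨k, hkw, hkc, hkl, fun o ho how hoc hol => ?_⟩
          rcases Nat.lt_succ_iff_lt_or_eq.mp ho with ho | rfl
          · exact hk o ho how hoc hol
          · exact absurd ⟨how, hoc, hol⟩ hN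
  have bound : ∀ o, MCOp.write o x ∈ H.ops → o < H.n + 1 := fun o ho =>
    Nat.lt_succ_of_le (H.tx_mem _ ho).2
  rcases key (H.n + 1) with h | ⟨k, hkw, hkc, hkl, hk⟩
  · exact ⟨0, Or.inl ⟨rfl, fun o how => h o (bound o how) how⟩⟩
  · exact ⟨k, Or.inr ⟨hkw, hkc, hkl, fun o how => hk o (bound o how) how⟩⟩

variable {H}

theorem lastWriteIdx.lt_write {x : D} {p : MCOp D} {v : ℕ} (h : H.lastWriteIdx x p v)
    (hv : v ≠ 0) : MCOp.write v x ∈ H.ops ∧ H.lt (.write v x) p := by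
  rcases h with ⟨rfl, -⟩ | ⟨hw, -, hl, -⟩
  · exact absurd rfl hv
  · exact ⟨hw, hl⟩

/-- A committed write before `p` is the last one or precedes the last one. -/
theorem lastWriteIdx.eq_or_lt {x : D} {p : MCOp D} {v o : ℕ} (h : H.lastWriteIdx x p v)
    (how : MCOp.write o x ∈ H.ops) (hoc : MCOp.commit o ∈ H.ops)
    (hol : H.lt (.write o x) p) :
    MCOp.write v x ∈ H.ops ∧ MCOp.commit v ∈ H.ops ∧ H.lt (.write v x) p ∧
      (o = v ∨ H.lt (.write o x) (.write v x)) := by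
  rcases h with ⟨-, h⟩ | ⟨hw, hc, hl, h⟩
  · exact absurd hol (h o how hoc)
  · exact ⟨hw, hc, hl, h o how hoc hol⟩

theorem write_mem_MVops {i : ℕ} {x : D} :
    MVOp.write i x ∈ H.MVops ↔ MCOp.write i x ∈ H.ops := by
  simp [MVops]

theorem commit_mem_MVops {i : ℕ} : MVOp.commit i ∈ H.MVops ↔ MCOp.commit i ∈ H.ops := by
  simp [MVops]

theorem mvlt_write_left {i : ℕ} {x : D} {q : MVOp D} :
    H.mvlt (.write i x) q ↔ H.lt (.write i x) q.pre := by
  simp [mvlt, MVOp.pre]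

theorem read_mem_MVops_of_read {i j v : ℕ} {x : D} (hr : MCOp.read i j x ∈ H.ops)
    (hv : H.lastWriteIdx x (.read i j x) v) : MVOp.read i (Sum.inl j) x v ∈ H.MVops :=
  Or.inl ⟨i, j, x, v, hr, hv, rfl⟩

/-- In an rw-history the reads of `MV(H)` stem from a read or a write on the same element. -/
theorem pre_of_read_mem_MVops (hrw : ∀ p ∈ H.ops, p.kind ≠ OpKind.m) {i v : ℕ} {h : MVSup}
    {x : D} (hm : MVOp.read i h x v ∈ H.MVops) :
    (MVOp.read i h x v).pre ∈ H.ops ∧ H.lastWriteIdx x (MVOp.read i h x v).pre v ∧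
      ((∃ j, (MVOp.read i h x v).pre = .read i j x) ∨
        (MVOp.read i h x v).pre = .write i x) := by
  rcases hm with ⟨i, j, x, v, hr, hv, he⟩ | ⟨i, x, -, he⟩ | ⟨i, x, v, hw, -, hv, he⟩ |
    ⟨i, k, l, x, v, hm, -⟩ | ⟨i, -, he⟩ | ⟨i, -, he⟩
  · cases he
    exact ⟨hr, hv, Or.inl ⟨j, rfl⟩⟩
  · cases he
  · cases he
    exact ⟨hw, hv, Or.inr rfl⟩
  · exact absurd rfl (hrw _ hm)
  · cases he
  · cases he

/-- Every write of `H` comes with a read of `MV(H)` that is not after it. -/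
theorem exists_read_of_write {i : ℕ} {x : D} (hw : MCOp.write i x ∈ H.ops) :
    ∃ (h : MVSup) (v : ℕ) (p : MCOp D), MVOp.read i h x v ∈ H.MVops ∧ H.lastWriteIdx x p v ∧
      (p = .write i x ∨ H.lt p (.write i x)) := by
  by_cases hr : ∃ k : ℕ, MCOp.read i k x ∈ H.ops ∧ H.lt (.read i k x) (.write i x)
  · obtain ⟨k, hk, hl⟩ := hr
    obtain ⟨v, hv⟩ := H.exists_lastWriteIdx x (.read i k x)
    exact ⟨_, v, _, read_mem_MVops_of_read hk hv, hv, Or.inr hl⟩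
  · obtain ⟨v, hv⟩ := H.exists_lastWriteIdx x (.write i x)
    exact ⟨_, v, _, Or.inr (Or.inr (Or.inl ⟨i, x, v, hw, hr, hv, rfl⟩)), hv, Or.inl rfl⟩

theorem SG.of_conflict {p q : MCOp D} (hne : p.tx ≠ q.tx) (hp : MCOp.commit p.tx ∈ H.ops)
    (hq : MCOp.commit q.tx ∈ H.ops) (hc : conflict H.ops p q) (hl : H.lt p q) :
    H.SG p.tx q.tx :=
  ⟨hne, hp, hq, p, q, (H.lt_mem _ _ hl).1, (H.lt_mem _ _ hl).2, rfl, rfl, hc, hl⟩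

variable {vlt : D → ℕ → ℕ → Prop}

theorem IsWriteVersionOrder.vlt_of_lt (hwvo : H.IsWriteVersionOrder vlt) {i j : ℕ} {x : D}
    (hl : H.lt (.write i x) (.write j x)) : vlt x i j :=
  hwvo i j x (write_mem_MVops.2 (H.lt_mem _ _ hl).1) (write_mem_MVops.2 (H.lt_mem _ _ hl).2)
    (Or.inl (mvlt_write_left.2 hl))

/-- Every edge of `MVSG(MV(H))` is realized by a path in `SG(H)`. -/
theorem MVSG.transGen_SG (hrw : ∀ p ∈ H.ops, p.kind ≠ OpKind.m) (hvo : IsVersionOrder vlt)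
    (hwvo : H.IsWriteVersionOrder vlt) {i j : ℕ} (he : H.MVSG vlt i j) :
    Relation.TransGen H.SG i j := by
  obtain ⟨hirr, htrans, -, -⟩ := hvo
  obtain ⟨hci, hcj, k, h, x, l, m, hr, hw, he⟩ := he
  rw [commit_mem_MVops] at hci hcj
  rw [write_mem_MVops] at hw
  obtain ⟨hpm, hlast, hpre⟩ := pre_of_read_mem_MVops hrw hr
  have hasymm : ∀ a b, vlt x a b → ¬ vlt x b a := fun a b hab hba =>
    hirr x a (htrans x a b a hab hba)
  rcases he with ⟨rfl, rfl, rfl, hne, hl⟩ | ⟨hne, rfl, rfl, rfl⟩ | ⟨hne, rfl, rfl, hv⟩ |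
    ⟨hne, rfl, rfl, hv⟩
  · rw [mvlt_write_left] at hl
    obtain ⟨-, hcl, hll, h'⟩ := hlast.eq_or_lt hw hci hl
    have hil := h'.resolve_left hne
    rcases hpre with ⟨s, hs⟩ | hs
    · rw [hs] at hll
      exact .tail (.single (SG.of_conflict (p := .write i x) (q := .write l x) hne hci hcl
        (H.conflict_write_write x hne) hil)) (SG.of_conflict (p := .write l x) (q := .read i s x)
        hne.symm hcl hci (H.conflict_write_read s x hne.symm) hll)
    · rw [hs] at hl
      exact absurd hl (H.lt_irrefl _)
  · have hl := (hlast.lt_write (H.write_ne_zero hw)).2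
    rcases hpre with ⟨s, hs⟩ | hs
    · rw [hs] at hl
      exact .single (SG.of_conflict (p := .write m x) (q := .read k s x) hne hci hcj
        (H.conflict_write_read s x hne) hl)
    · rw [hs] at hl
      exact .single (SG.of_conflict (p := .write m x) (q := .write k x) hne hci hcj
        (H.conflict_write_write x hne) hl)
  · have hwl := (hlast.lt_write (H.commit_ne_zero hcj)).1
    rcases H.lt_or_lt_of_write hw hwl hne with hl | hl
    · exact .single (SG.of_conflict (p := .write m x) (q := .write l x) hne hci hcj
        (H.conflict_write_write x hne) hl)
    · exact absurd (hwvo.vlt_of_lt hl) (hasymm _ _ hv)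
  · have hnot : ¬ H.lt (.write m x) (MVOp.read k h x l).pre := by
      intro hl
      rcases (hlast.eq_or_lt hw hcj hl).2.2.2 with rfl | h'
      · exact hirr _ _ hv
      · exact hasymm _ _ hv (hwvo.vlt_of_lt h')
    rcases hpre with ⟨s, hs⟩ | hs
    · rw [hs] at hnot hpm
      have hc := H.conflict_read_write s x hne
      exact .single (SG.of_conflict (p := .read k s x) (q := .write m x) hne hci hcj hc
        ((H.well_defined _ hpm _ hw hc).resolve_right hnot))
    · rw [hs] at hnot hpm
      exact .single (SG.of_conflict (p := .write k x) (q := .write m x) hne hci hcj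
        (H.conflict_write_write x hne) ((H.lt_or_lt_of_write hpm hw hne).resolve_right hnot))

/-- A read of `MV(H)` yields an edge to each transaction writing the element later. -/
theorem MVSG.of_read_lt_write (hvo : IsVersionOrder vlt) (hwvo : H.IsWriteVersionOrder vlt)
    {i j v : ℕ} {h : MVSup} {x : D} {p : MCOp D} (hne : i ≠ j) (hci : MCOp.commit i ∈ H.ops)
    (hcj : MCOp.commit j ∈ H.ops) (hr : MVOp.read i h x v ∈ H.MVops)
    (hv : H.lastWriteIdx x p v) (hl : H.lt p (.write j x)) : H.MVSG vlt i j := by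
  have hw := (H.lt_mem _ _ hl).2
  refine ⟨commit_mem_MVops.2 hci, commit_mem_MVops.2 hcj, i, h, x, v, j, hr,
    write_mem_MVops.2 hw, Or.inr (Or.inr (Or.inr ⟨hne, rfl, rfl, ?_⟩))⟩
  by_cases hv0 : v = 0
  · exact hv0 ▸ hvo.2.2.1 x j (H.write_ne_zero hw)
  · exact hwvo.vlt_of_lt (H.lt_trans _ _ _ (hv.lt_write hv0).2 hl)

/-- Every edge of `SG(H)` is realized by a path in `MVSG(MV(H))`. -/
theorem SG.transGen_MVSG (hrw : ∀ p ∈ H.ops, p.kind ≠ OpKind.m) (hvo : IsVersionOrder vlt)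
    (hwvo : H.IsWriteVersionOrder vlt) {i j : ℕ} (he : H.SG i j) :
    Relation.TransGen (H.MVSG vlt) i j := by
  obtain ⟨hne, hci, hcj, p, q, hp, hq, rfl, rfl, ⟨⟨x, hxp, hxq⟩, hk⟩, hl⟩ := he
  have hpm := hrw p hp
  have hqm := hrw q hq
  rcases p with ⟨i, s, y⟩ | ⟨i, y⟩ | ⟨i, s, t⟩ | i | i <;>
    rcases q with ⟨j, s', z⟩ | ⟨j, z⟩ | ⟨j, s', t'⟩ | j | j <;>
    simp only [MCOp.kind, MCOp.tx, dset, Set.mem_singleton_iff, Set.mem_empty_iff_false,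
      ne_eq, not_true_eq_false, reduceCtorEq, or_self, and_false, and_true]
      at hpm hqm hxp hxq hk hne hci hcj ⊢
  · subst hxp hxq
    obtain ⟨v, hv⟩ := H.exists_lastWriteIdx x (.read i s x)
    exact .single
      (MVSG.of_read_lt_write hvo hwvo hne hci hcj (read_mem_MVops_of_read hp hv) hv hl)
  · subst hxp hxq
    obtain ⟨v, hv⟩ := H.exists_lastWriteIdx x (.read j s' x)
    have hr := read_mem_MVops_of_read hq hv
    obtain ⟨hwv, hcv, -, h'⟩ := hv.eq_or_lt hp hci hl
    have hfrom : v ≠ j → H.MVSG vlt v j := fun hvj =>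
      ⟨commit_mem_MVops.2 hcv, commit_mem_MVops.2 hcj, j, _, x, v, v, hr,
        write_mem_MVops.2 hwv, Or.inr (Or.inl ⟨hvj, rfl, rfl, rfl⟩)⟩
    by_cases hiv : i = v
    · subst hiv
      exact .single (hfrom hne)
    · have hedge : H.MVSG vlt i v :=
        ⟨commit_mem_MVops.2 hci, commit_mem_MVops.2 hcv, j, _, x, v, i, hr,
          write_mem_MVops.2 hp, Or.inr (Or.inr (Or.inl
            ⟨hiv, rfl, rfl, hwvo.vlt_of_lt (h'.resolve_left hiv)⟩))⟩
      by_cases hvj : v = j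
      · exact hvj ▸ .single hedge
      · exact .tail (.single hedge) (hfrom hvj)
  · subst hxp hxq
    obtain ⟨h, v, p, hr, hv, hpw⟩ := exists_read_of_write hp
    refine .single (MVSG.of_read_lt_write hvo hwvo hne hci hcj hr hv ?_)
    rcases hpw with rfl | hpw
    · exact hl
    · exact H.lt_trans _ _ _ hpw hl

end MCHistory

/-- Theorem 1 of the paper. For an rw-history `H` (a history whose
operations contain no method operations, i.e. `RW(H) = H`) and any write version
order, the transitive closure of the 1-version serializability graph of `H` equals
the transitive closure of the multiversion serializability graph of `MV(H)`. -/
theorem sg_transClosure_eq_mvsg_transClosure {D : Type} (H : MCHistory D)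
    (hrw : ∀ p ∈ H.ops, p.kind ≠ OpKind.m)
    (vlt : D → ℕ → ℕ → Prop)
    (hvo : IsVersionOrder vlt) (hwvo : H.IsWriteVersionOrder vlt) :
    ∀ i j : ℕ, Relation.TransGen H.SG i j ↔ Relation.TransGen (H.MVSG vlt) i j := by
  intro i j
  constructor <;> intro h
  · induction h with
    | single he => exact he.transGen_MVSG hrw hvo hwvo
    | tail _ he ih => exact ih.trans (he.transGen_MVSG hrw hvo hwvo)
  · induction h with
    | single he => exact he.transGen_SG hrw hvo hwvo
    | tail _ he ih => exact ih.trans (he.transGen_SG hrw hvo hwvo)
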